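/- Let h > 0. Define g : ℤ → ℝ by g(l) = l·tanh(h·l), and β : ℤ → ℝ by β(k) = 1/2 if k ∈ {1, −1} and β(k) = 0 otherwise. Then g(1) ≠ g(l) for every l ∈ ℤ with l ∉ {1, −1}, and Σ_{l ∈ ℤ, l ∉ {1, −1}} β(1 − l)·β(1 + l)·( l² − g(1)·g(l) ) / ( g(1) − g(l) ) = 0. -/

import Mathlib

theorem Real.strictMono_tanh : StrictMono Real.tanh := fun x y hxy => by
  rw [Real.tanh_eq_sinh_div_cosh, Real.tanh_eq_sinh_div_cosh,
    div_lt_div_iff₀ (Real.cosh_pos x) (Real.cosh_pos y)]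
  have hsinh := Real.sinh_pos_iff.2 (sub_pos.2 hxy)
  rw [Real.sinh_sub] at hsinh
  linarith

theorem Real.tanh_pos_of_pos {x : ℝ} (hx : 0 < x) : 0 < Real.tanh x :=
  Real.tanh_zero ▸ Real.strictMono_tanh hx

/-- The dispersion profile `x * tanh x` is strictly increasing on the positive reals. -/
theorem Real.mul_tanh_lt_mul_tanh {x y : ℝ} (hx : 0 < x) (hxy : x < y) :
    x * Real.tanh x < y * Real.tanh y :=
  mul_lt_mul hxy (Real.strictMono_tanh hxy).le (Real.tanh_pos_of_pos hx) (hx.trans hxy).le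

/-- The dispersion profile `x * tanh x` is even. -/
theorem Real.neg_mul_tanh_neg (x : ℝ) : -x * Real.tanh (-x) = x * Real.tanh x := by
  rw [Real.tanh_neg, neg_mul_neg]

/-- The dispersion profile `x * tanh x` is injective up to sign away from zero. -/
theorem Real.eq_abs_of_mul_tanh_eq {x y : ℝ} (hx : 0 < x)
    (hxy : x * Real.tanh x = y * Real.tanh y) : x = |y| := by
  have habs : y * Real.tanh y = |y| * Real.tanh |y| := by
    rcases abs_choice y with hy | hy <;> rw [hy]
    exact (Real.neg_mul_tanh_neg y).symm
  rw [habs] at hxy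
  rcases lt_trichotomy x |y| with hlt | heq | hgt
  · exact absurd hxy (Real.mul_tanh_lt_mul_tanh hx hlt).ne
  · exact heq
  · rcases (abs_nonneg y).eq_or_lt with hy | hy
    · rw [← hy, zero_mul] at hxy
      exact absurd hxy (mul_pos hx (Real.tanh_pos_of_pos hx)).ne'
    · exact absurd hxy (Real.mul_tanh_lt_mul_tanh hy hgt).ne'

/-- For the bathymetry `b(x) = ε·cos x` (Fourier coefficients `β(±1) = 1/2`, all others
zero), with `g(l) = l·tanh(h·l)`: `g(1) ≠ g(l)` for `l ∉ {1, −1}`, and the order-`ε²`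
coefficient of the second gap vanishes:
`Σ_{l∉{1,−1}} β(1−l)·β(1+l)·(l² − g(1)·g(l))/(g(1) − g(l)) = 0`. -/
theorem second_gap_coefficient_vanishes_for_cosine
    (h : ℝ) (hh : 0 < h)
    (g : ℤ → ℝ) (hg : ∀ l : ℤ, g l = (l : ℝ) * Real.tanh (h * (l : ℝ)))
    (β : ℤ → ℝ) (hβ : ∀ k : ℤ, β k = if k = 1 ∨ k = -1 then 1 / 2 else 0) :
    (∀ l : ℤ, l ≠ 1 → l ≠ -1 → g 1 ≠ g l) ∧
    (∑' l : {l : ℤ // l ≠ 1 ∧ l ≠ -1},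
        β (1 - (l : ℤ)) * β (1 + (l : ℤ)) *
          (((l : ℤ) : ℝ) ^ 2 - g 1 * g (l : ℤ)) / (g 1 - g (l : ℤ))) = 0 := by
  refine ⟨fun l hl hl' heq => ?_, ?_⟩
  · have hscaled : h * Real.tanh h = (h * l) * Real.tanh (h * l) := by
      rw [hg, hg, Int.cast_one, one_mul, mul_one] at heq
      rw [heq, mul_assoc]
    have habs := Real.eq_abs_of_mul_tanh_eq hh hscaled
    rw [abs_mul, abs_of_pos hh, left_eq_mul₀ hh.ne'] at habs
    have hl_abs : |l| = 1 := by exact_mod_cast habs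
    rcases eq_or_eq_neg_of_abs_eq hl_abs with hl_one | hl_neg
    · exact hl hl_one
    · exact hl' hl_neg
  · refine (tsum_congr fun l => ?_).trans tsum_zero
    rcases eq_or_ne (l : ℤ) 0 with hl | hl
    · simp [hl, hg 0]
    · have hβ_zero : β (1 - (l : ℤ)) = 0 ∨ β (1 + (l : ℤ)) = 0 := by
        simp only [hβ]
        grind
      rcases hβ_zero with hβ_zero | hβ_zero <;> simp [hβ_zero]
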